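/- arXiv:hep-th/9605076 — 2 statements merged into one kernel-verified Lean document; each statement's English description precedes it below -/
import Mathlib

section
/- Order-reduction theorem: Let t^{μν}_{AB} and t_A (μ,ν = 1,…,n; A,B = 1,…,N) be first-order functions such that the second-order expressions T_A = Σ_{μ,ν,B} t^{μν}_{AB} ψ^B_{μν} + t_A satisfy the Anderson–Duchamp–Krupka local variationality conditions (eq1)–(eq7). Then there exists a first-order function L such that t^{μν}_{AB} = −(1/2)(∂^μ_A ∂^ν_B + ∂^ν_A ∂^μ_B) L and t_A = ∂_A L − Σ_μ (δ/δx^μ) ∂^μ_A L; equivalently, T_A is the Euler–Lagrange expression of the first-order Lagrangian L. -/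
/-!
The order-reduction theorem: if the second-order expressions
`T_A = Σ t^{μν}_{AB} ψᴮ_{μν} + t_A` (with first-order coefficients) satisfy
the Anderson–Duchamp–Krupka local variationality conditions (eq1)–(eq7), then
there is a first-order Lagrangian `L` with
`t^{μν}_{AB} = -(1/2)(∂ᵘ_A ∂ᵛ_B + ∂ᵛ_A ∂ᵘ_B) L` and
`t_A = ∂_A L − Σ_μ (δ/δxᵘ) ∂ᵘ_A L`.
-/

/-- The first-order jet-type space `J = ℝ^n × ℝ^N × ℝ^{N×n}`. -/
abbrev J (n N : ℕ) : Type :=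
  (Fin n → ℝ) × (Fin N → ℝ) × (Fin N → Fin n → ℝ)

/-- `∂ᵘ_A f`: the partial derivative with respect to the variable `ψᴬ_μ`. -/
noncomputable def pd {n N : ℕ} (A : Fin N) (μ : Fin n) (f : J n N → ℝ) :
    J n N → ℝ :=
  fun p => fderiv ℝ f p (0, 0, Pi.single A (Pi.single μ (1 : ℝ)))

/-- `∂_A f`: the partial derivative with respect to the variable `ψᴬ`. -/
noncomputable def pd0 {n N : ℕ} (A : Fin N) (f : J n N → ℝ) : J n N → ℝ :=
  fun p => fderiv ℝ f p (0, Pi.single A (1 : ℝ), 0)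

/-- `∂f/∂xᵘ`: the partial derivative with respect to the variable `xᵘ`. -/
noncomputable def pdx {n N : ℕ} (μ : Fin n) (f : J n N → ℝ) : J n N → ℝ :=
  fun p => fderiv ℝ f p (Pi.single μ (1 : ℝ), 0, 0)

/-- `δ/δxᵘ ≡ ∂/∂xᵘ + Σ_A ψᴬ_μ ∂_A`. -/
noncomputable def deltaX {n N : ℕ} (μ : Fin n) (f : J n N → ℝ) : J n N → ℝ :=
  fun p => pdx μ f p + ∑ A, p.2.2 A μ * pd0 A f p

open scoped ContDiff

section ParametricIntegral

variable {E : Type} [NormedAddCommGroup E] [NormedSpace ℝ E] [FiniteDimensional ℝ E]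

theorem hasFDerivAt_integral_zero_one {G : Type} [NormedAddCommGroup G] [NormedSpace ℝ G]
    [CompleteSpace G] {F : E × ℝ → G} (hF : ContDiff ℝ 1 F) (x : E) :
    HasFDerivAt (fun y => ∫ s in (0 : ℝ)..1, F (y, s))
      (∫ s in (0 : ℝ)..1, (fderiv ℝ F (x, s)).comp (ContinuousLinearMap.inl ℝ E ℝ)) x := by
  have hproper : ProperSpace E := FiniteDimensional.proper ℝ E
  have hF' : Continuous fun q : E × ℝ =>
      (fderiv ℝ F q).comp (ContinuousLinearMap.inl ℝ E ℝ) :=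
    (hF.continuous_fderiv one_ne_zero).clm_comp continuous_const
  have hslice : ∀ y : E, Continuous fun s : ℝ => (y, s) := fun y => by fun_prop
  obtain ⟨C, hC⟩ := ((isCompact_closedBall x 1).prod (isCompact_Icc (a := (0 : ℝ)) (b := 1))
    ).exists_bound_of_continuousOn hF'.continuousOn
  refine intervalIntegral.hasFDerivAt_integral_of_dominated_of_fderiv_le
    (F' := fun y s => (fderiv ℝ F (y, s)).comp (ContinuousLinearMap.inl ℝ E ℝ))
    (bound := fun _ => C) (Metric.closedBall_mem_nhds x one_pos) ?_ ?_ ?_ ?_ ?_ ?_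
  · exact Filter.Eventually.of_forall fun y =>
      (hF.continuous.comp (hslice y)).aestronglyMeasurable
  · exact (hF.continuous.comp (hslice x)).intervalIntegrable _ _
  · exact (hF'.comp (hslice x)).aestronglyMeasurable
  · refine Filter.Eventually.of_forall fun s hs y hy => hC (y, s) ⟨hy, ?_⟩
    rw [Set.uIoc_of_le zero_le_one] at hs
    exact ⟨hs.1.le, hs.2⟩
  · exact intervalIntegrable_const
  · refine Filter.Eventually.of_forall fun s _ y _ => ?_
    exact ((hF.differentiable one_ne_zero) (y, s)).hasFDerivAt.comp y (hasFDerivAt_prodMk_left y s)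

theorem contDiff_integral_zero_one (k : ℕ) : ∀ {G : Type} [NormedAddCommGroup G]
    [NormedSpace ℝ G] [CompleteSpace G] {F : E × ℝ → G}, ContDiff ℝ ∞ F →
      ContDiff ℝ k (fun y => ∫ s in (0 : ℝ)..1, F (y, s)) := by
  induction k with
  | zero =>
    intro G _ _ _ F hF
    refine contDiff_zero.2 (continuous_iff_continuousAt.2 fun x => ?_)
    exact (hasFDerivAt_integral_zero_one (hF.of_le (by simp)) x).continuousAt
  | succ k ih =>
    intro G _ _ _ F hF
    refine contDiff_succ_iff_hasFDerivAt.2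
      ⟨_, ?_, hasFDerivAt_integral_zero_one (hF.of_le (by simp))⟩
    exact ih ((hF.fderiv_right (by simp)).clm_comp contDiff_const)

end ParametricIntegral

section SmoothFunctions

theorem two_le_infty : (2 : WithTop ℕ∞) ≤ ∞ :=
  WithTop.coe_le_coe.2 (le_top : (2 : ℕ∞) ≤ ⊤)

variable {E : Type} [NormedAddCommGroup E] [NormedSpace ℝ E]

variable (E) in
/-- The algebra of smooth real-valued functions on a normed space. -/
def smoothFunctions : Subalgebra ℝ (E → ℝ) where
  carrier := {f | ContDiff ℝ ∞ f}
  mul_mem' {f g} (hf : ContDiff ℝ ∞ f) (hg : ContDiff ℝ ∞ g) := by exact hf.mul hg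
  add_mem' {f g} (hf : ContDiff ℝ ∞ f) (hg : ContDiff ℝ ∞ g) := by exact hf.add hg
  algebraMap_mem' c := (contDiff_const : ContDiff ℝ ∞ fun _ : E => c)

theorem mem_smoothFunctions {f : E → ℝ} : f ∈ smoothFunctions E ↔ ContDiff ℝ ∞ f := Iff.rfl

theorem contDiff_smoothFunctions (f : smoothFunctions E) : ContDiff ℝ ∞ (f : E → ℝ) :=
  mem_smoothFunctions.1 f.2

theorem differentiable_smoothFunctions (f : smoothFunctions E) :
    Differentiable ℝ (f : E → ℝ) := (contDiff_smoothFunctions f).differentiable (by simp)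

/-- The directional derivative along a constant vector, as a derivation. -/
noncomputable def dirDeriv (w : E) : Derivation ℝ (smoothFunctions E) (smoothFunctions E) :=
  Derivation.mk'
    { toFun := fun f => ⟨fun p => fderiv ℝ (f : E → ℝ) p w,
        mem_smoothFunctions.2
          (((contDiff_smoothFunctions f).fderiv_right le_rfl).clm_apply contDiff_const)⟩
      map_add' := fun f g => by
        ext p
        exact congrArg (· w) (fderiv_add (differentiable_smoothFunctions f p)
          (differentiable_smoothFunctions g p))
      map_smul' := fun c f => by
        ext p
        exact congrArg (· w) (fderiv_const_smul (differentiable_smoothFunctions f p) c) }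
    fun f g => by
      ext p
      exact congrArg (· w) (fderiv_mul (differentiable_smoothFunctions f p)
        (differentiable_smoothFunctions g p))

theorem dirDeriv_apply (w : E) (f : smoothFunctions E) (p : E) :
    (dirDeriv w f : E → ℝ) p = fderiv ℝ (f : E → ℝ) p w := rfl

theorem dirDeriv_comm (w z : E) (f : smoothFunctions E) :
    dirDeriv w (dirDeriv z f) = dirDeriv z (dirDeriv w f) := by
  have hf : ContDiff ℝ ∞ (f : E → ℝ) := contDiff_smoothFunctions f
  have h2 : ∀ p a b, fderiv ℝ (fun q => fderiv ℝ (f : E → ℝ) q a) p b =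
      fderiv ℝ (fderiv ℝ (f : E → ℝ)) p b a := fun p a b => by
    have hd : DifferentiableAt ℝ (fderiv ℝ (f : E → ℝ)) p :=
      (hf.fderiv_right (m := 1) (by rw [one_add_one_eq_two]; exact two_le_infty)).differentiable
        one_ne_zero p
    rw [fderiv_clm_apply hd (differentiableAt_const a)]
    simp
  ext p
  refine (h2 p z w).trans (Eq.trans ?_ (h2 p w z).symm)
  exact (hf.contDiffAt.isSymmSndFDerivAt (by simpa using two_le_infty)).eq w z

/-- A continuous linear functional as a smooth function. -/
def linearFunction (l : E →L[ℝ] ℝ) : smoothFunctions E := ⟨l, mem_smoothFunctions.2 l.contDiff⟩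

theorem dirDeriv_linearFunction (w : E) (l : E →L[ℝ] ℝ) :
    dirDeriv w (linearFunction l) = algebraMap ℝ _ (l w) := by
  ext p
  exact congrArg (· w) (l.fderiv (x := p))

/-- The linear map fixing the kernel and scaling the range of an idempotent `P` by `s`. -/
def partialScaling (P : E →L[ℝ] E) (s : ℝ) : E →L[ℝ] E :=
  ContinuousLinearMap.id ℝ E + (s - 1) • P

theorem partialScaling_apply (P : E →L[ℝ] E) (s : ℝ) (p : E) :
    partialScaling P s p = p + (s - 1) • P p := rfl

theorem contDiff_partialScaling_integrand (P : E →L[ℝ] E) (k : ℕ) (f : smoothFunctions E) :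
    ContDiff ℝ ∞ fun q : E × ℝ => q.2 ^ k * (f : E → ℝ) (partialScaling P q.2 q.1) := by
  have := contDiff_smoothFunctions f
  simp only [partialScaling_apply]
  fun_prop

variable [FiniteDimensional ℝ E]

omit [FiniteDimensional ℝ E] in
theorem intervalIntegrable_partialScaling (P : E →L[ℝ] E) (k : ℕ) (f : smoothFunctions E) (p : E) :
    IntervalIntegrable (fun s => s ^ k * (f : E → ℝ) (partialScaling P s p))
      MeasureTheory.volume 0 1 :=
  ((contDiff_partialScaling_integrand P k f).continuous.comp
    (by fun_prop : Continuous fun s : ℝ => (p, s))).intervalIntegrable _ _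

/-- The weighted average of `f` over partial rescalings of its argument. -/
noncomputable def scalingIntegral (P : E →L[ℝ] E) (k : ℕ) :
    smoothFunctions E →ₗ[ℝ] smoothFunctions E where
  toFun f := ⟨fun p => ∫ s in (0 : ℝ)..1, s ^ k * (f : E → ℝ) (partialScaling P s p),
    mem_smoothFunctions.2 <| contDiff_infty.2 fun m =>
      contDiff_integral_zero_one m (contDiff_partialScaling_integrand P k f)⟩
  map_add' f g := by
    ext p
    refine Eq.trans ?_ (intervalIntegral.integral_add (intervalIntegrable_partialScaling P k f p)
      (intervalIntegrable_partialScaling P k g p))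
    refine intervalIntegral.integral_congr fun s _ => ?_
    exact mul_add _ _ _
  map_smul' c f := by
    ext p
    refine Eq.trans ?_ (intervalIntegral.integral_const_mul c _)
    refine intervalIntegral.integral_congr fun s _ => ?_
    exact mul_left_comm _ _ _

theorem scalingIntegral_apply (P : E →L[ℝ] E) (k : ℕ) (f : smoothFunctions E) (p : E) :
    (scalingIntegral P k f : E → ℝ) p =
      ∫ s in (0 : ℝ)..1, s ^ k * (f : E → ℝ) (partialScaling P s p) := rfl

theorem dirDeriv_scalingIntegral (P : E →L[ℝ] E) (k : ℕ) (f : smoothFunctions E) (w : E) (p : E) :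
    (dirDeriv w (scalingIntegral P k f) : E → ℝ) p =
      ∫ s in (0 : ℝ)..1, s ^ k * fderiv ℝ (f : E → ℝ) (partialScaling P s p)
        (partialScaling P s w) := by
  have hF := (contDiff_partialScaling_integrand P k f).of_le (m := 1) (by simp)
  have h := hasFDerivAt_integral_zero_one hF p
  have hint : IntervalIntegrable (fun s => (fderiv ℝ (fun q : E × ℝ => q.2 ^ k *
      (f : E → ℝ) (partialScaling P q.2 q.1)) (p, s)).comp (ContinuousLinearMap.inl ℝ E ℝ))
      MeasureTheory.volume 0 1 :=
    (((hF.continuous_fderiv one_ne_zero).clm_comp continuous_const).comp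
      (by fun_prop : Continuous fun s : ℝ => (p, s))).intervalIntegrable _ _
  refine (congrArg (· w) h.fderiv).trans ?_
  refine (ContinuousLinearMap.intervalIntegral_apply hint w).trans ?_
  refine intervalIntegral.integral_congr fun s _ => ?_
  have h1 := ((hF.differentiable one_ne_zero) (p, s)).hasFDerivAt.comp (f := fun y => (y, s)) p
    (hasFDerivAt_prodMk_left p s)
  have h2 : HasFDerivAt (fun y => s ^ k * (f : E → ℝ) (partialScaling P s y))
      (s ^ k • (fderiv ℝ (f : E → ℝ) (partialScaling P s p)).comp (partialScaling P s)) p :=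
    ((differentiable_smoothFunctions f _).hasFDerivAt.comp p
      (partialScaling P s).hasFDerivAt).const_mul _
  exact congrArg (· w) (h1.unique h2)

theorem dirDeriv_scalingIntegral_of_ker {P : E →L[ℝ] E} {w : E} (hw : P w = 0) (k : ℕ)
    (f : smoothFunctions E) :
    dirDeriv w (scalingIntegral P k f) = scalingIntegral P k (dirDeriv w f) := by
  ext p
  rw [dirDeriv_scalingIntegral, scalingIntegral_apply]
  refine intervalIntegral.integral_congr fun s _ => ?_
  simp [partialScaling_apply P s w, hw, dirDeriv_apply]

theorem dirDeriv_scalingIntegral_of_fixed {P : E →L[ℝ] E} {w : E} (hw : P w = w) (k : ℕ)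
    (f : smoothFunctions E) :
    dirDeriv w (scalingIntegral P k f) = scalingIntegral P (k + 1) (dirDeriv w f) := by
  ext p
  rw [dirDeriv_scalingIntegral, scalingIntegral_apply]
  refine intervalIntegral.integral_congr fun s _ => ?_
  have hs : partialScaling P s w = s • w := by
    rw [partialScaling_apply, hw, sub_smul, one_smul, add_sub_cancel]
  simp only [hs, map_smul, smul_eq_mul, dirDeriv_apply]
  ring

theorem scalingIntegral_linearFunction_mul_of_fixed {P : E →L[ℝ] E} {l : E →L[ℝ] ℝ}
    (hl : ∀ p, l (P p) = l p) (k : ℕ) (f : smoothFunctions E) :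
    scalingIntegral P k (linearFunction l * f) =
      linearFunction l * scalingIntegral P (k + 1) f := by
  ext p
  refine Eq.trans ?_ (intervalIntegral.integral_const_mul (l p) _)
  refine intervalIntegral.integral_congr fun s _ => ?_
  have : (linearFunction l : E → ℝ) (partialScaling P s p) = s * l p := by
    simp only [linearFunction, partialScaling_apply, map_add, map_smul, hl, smul_eq_mul]
    ring
  change s ^ k * ((linearFunction l : E → ℝ) _ * (f : E → ℝ) _) = l p * _
  rw [this]
  ring

theorem scalingIntegral_euler {ι : Type*} (I : Finset ι) {P : E →L[ℝ] E} {l : ι → E →L[ℝ] ℝ}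
    {w : ι → E} (hP : ∀ p, P p = ∑ i ∈ I, l i p • w i) (k : ℕ) (f : smoothFunctions E) :
    (k + 1 : ℝ) • scalingIntegral P k f +
      ∑ i ∈ I, linearFunction (l i) * scalingIntegral P (k + 1) (dirDeriv (w i) f) = f := by
  ext p
  have hderiv : ∀ s ∈ Set.uIcc (0 : ℝ) 1, HasDerivAt
      (fun s => s ^ (k + 1) * (f : E → ℝ) (partialScaling P s p))
      ((k + 1 : ℝ) * (s ^ k * (f : E → ℝ) (partialScaling P s p)) +
        ∑ i ∈ I, l i p * (s ^ (k + 1) * (dirDeriv (w i) f : E → ℝ) (partialScaling P s p))) s := by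
    intro s _
    have h1 : HasDerivAt (fun s => partialScaling P s p) (P p) s := by
      simp only [partialScaling_apply]
      simpa using (((hasDerivAt_id s).sub_const 1).smul_const (P p)).const_add p
    have h2 := (differentiable_smoothFunctions f (partialScaling P s p)).hasFDerivAt
      |>.comp_hasDerivAt s h1
    refine ((hasDerivAt_pow (k + 1) s).mul h2).congr_deriv ?_
    rw [hP p, map_sum, Finset.mul_sum]
    simp only [map_smul, smul_eq_mul, dirDeriv_apply, Function.comp_apply, Nat.cast_add,
      Nat.cast_one, Nat.add_sub_cancel]
    congr 1
    · ring
    · exact Finset.sum_congr rfl fun i _ => by ring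
  have hi : ∀ i, IntervalIntegrable (fun s => l i p * (s ^ (k + 1) *
      (dirDeriv (w i) f : E → ℝ) (partialScaling P s p))) MeasureTheory.volume 0 1 := fun i =>
    (intervalIntegrable_partialScaling P (k + 1) _ p).const_mul _
  have hsum : IntervalIntegrable (fun s => ∑ i ∈ I, l i p * (s ^ (k + 1) *
      (dirDeriv (w i) f : E → ℝ) (partialScaling P s p))) MeasureTheory.volume 0 1 := by
    simpa [Finset.sum_fn] using IntervalIntegrable.sum I fun i _ => hi i
  have h0 := (intervalIntegrable_partialScaling P k f p).const_mul (k + 1 : ℝ)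
  have h := intervalIntegral.integral_eq_sub_of_hasDerivAt hderiv (h0.add hsum)
  rw [intervalIntegral.integral_add h0 hsum, intervalIntegral.integral_finsetSum fun i _ => hi i]
    at h
  simp only [intervalIntegral.integral_const_mul] at h
  simp [partialScaling_apply P 1 p] at h
  simpa [linearFunction, scalingIntegral_apply] using h

end SmoothFunctions

section JetSpace

variable {n N : ℕ}

/-- `∂/∂ψᴬ_μ` as a derivation of the smooth functions. -/
noncomputable abbrev dVel (A : Fin N) (μ : Fin n) :
    Derivation ℝ (smoothFunctions (J n N)) (smoothFunctions (J n N)) :=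
  dirDeriv (0, 0, Pi.single A (Pi.single μ 1))

/-- `∂/∂ψᴬ` as a derivation of the smooth functions. -/
noncomputable abbrev dField (n : ℕ) {N : ℕ} (A : Fin N) :
    Derivation ℝ (smoothFunctions (J n N)) (smoothFunctions (J n N)) :=
  dirDeriv (0, Pi.single A 1, 0)

/-- `∂/∂xᵘ` as a derivation of the smooth functions. -/
noncomputable abbrev dBase {n : ℕ} (N : ℕ) (μ : Fin n) :
    Derivation ℝ (smoothFunctions (J n N)) (smoothFunctions (J n N)) :=
  dirDeriv (Pi.single μ 1, 0, 0)

/-- The coordinate functional `ψᴬ_μ`. -/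
noncomputable def velFunctional (A : Fin N) (μ : Fin n) : J n N →L[ℝ] ℝ :=
  (ContinuousLinearMap.proj μ).comp <| (ContinuousLinearMap.proj A).comp <|
    (ContinuousLinearMap.snd ℝ (Fin N → ℝ) (Fin N → Fin n → ℝ)).comp
      (ContinuousLinearMap.snd ℝ (Fin n → ℝ) _)

/-- The coordinate functional `ψᴬ`. -/
noncomputable def fieldFunctional (n : ℕ) {N : ℕ} (A : Fin N) : J n N →L[ℝ] ℝ :=
  (ContinuousLinearMap.proj A).comp <|
    (ContinuousLinearMap.fst ℝ (Fin N → ℝ) (Fin N → Fin n → ℝ)).comp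
      (ContinuousLinearMap.snd ℝ (Fin n → ℝ) _)

/-- The coordinate function `ψᴬ_μ`. -/
noncomputable abbrev vel (A : Fin N) (μ : Fin n) : smoothFunctions (J n N) :=
  linearFunction (velFunctional A μ)

/-- The coordinate function `ψᴬ`. -/
noncomputable abbrev field (n : ℕ) {N : ℕ} (A : Fin N) : smoothFunctions (J n N) :=
  linearFunction (fieldFunctional n A)

theorem velFunctional_apply (A : Fin N) (μ : Fin n) (p : J n N) :
    velFunctional A μ p = p.2.2 A μ := rfl

theorem fieldFunctional_apply (A : Fin N) (p : J n N) : fieldFunctional n A p = p.2.1 A := rfl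

theorem dVel_vel (A B : Fin N) (μ ν : Fin n) :
    dVel B ν (vel A μ) = if B = A then if ν = μ then 1 else 0 else 0 := by
  rw [dirDeriv_linearFunction, velFunctional_apply]
  split_ifs with h1 h2
  · subst h1 h2; simp
  · subst h1; simp [Pi.single_eq_of_ne' h2]
  · simp [Pi.single_eq_of_ne' h1]

theorem dVel_field (A B : Fin N) (ν : Fin n) : dVel B ν (field n A) = 0 := by
  rw [dirDeriv_linearFunction, fieldFunctional_apply]
  simp

theorem dField_vel (A B : Fin N) (μ : Fin n) : dField n B (vel A μ) = 0 := by
  rw [dirDeriv_linearFunction, velFunctional_apply]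
  simp

theorem dBase_vel (A : Fin N) (μ ν : Fin n) : dBase N ν (vel A μ) = 0 := by
  rw [dirDeriv_linearFunction, velFunctional_apply]
  simp

theorem dField_field (A B : Fin N) : dField n B (field n A) = if B = A then 1 else 0 := by
  rw [dirDeriv_linearFunction, fieldFunctional_apply]
  split_ifs with h
  · subst h; simp
  · simp [Pi.single_eq_of_ne' h]

theorem dBase_field (A : Fin N) (ν : Fin n) : dBase N ν (field n A) = 0 := by
  rw [dirDeriv_linearFunction, fieldFunctional_apply]
  simp

theorem dVel_comm (A B : Fin N) (μ ν : Fin n) (f : smoothFunctions (J n N)) :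
    dVel A μ (dVel B ν f) = dVel B ν (dVel A μ f) := dirDeriv_comm _ _ f

/-- Twice the part of the Hessian in the `ψᴬ_μ` that is symmetric in the base indices. -/
noncomputable def symHess (μ ν : Fin n) (A B : Fin N) (L : smoothFunctions (J n N)) :
    smoothFunctions (J n N) :=
  dVel A μ (dVel B ν L) + dVel A ν (dVel B μ L)

theorem symHess_add (μ ν : Fin n) (A B : Fin N) (L M : smoothFunctions (J n N)) :
    symHess μ ν A B (L + M) = symHess μ ν A B L + symHess μ ν A B M := by
  simp only [symHess, map_add]
  abel

theorem symHess_index_comm (μ ν : Fin n) (A B : Fin N) (L : smoothFunctions (J n N)) :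
    symHess μ ν A B L = symHess ν μ A B L := add_comm _ _

theorem symHess_field_comm (μ ν : Fin n) (A B : Fin N) (L : smoothFunctions (J n N)) :
    symHess μ ν A B L = symHess μ ν B A L :=
  (congrArg₂ _ (dirDeriv_comm _ _ L) (dirDeriv_comm _ _ L)).trans (add_comm _ _)

theorem symHess_zero (μ ν : Fin n) (A B : Fin N) :
    symHess μ ν A B (0 : smoothFunctions (J n N)) = 0 := by simp [symHess]

/-- The conditions on second-order coefficients that do not involve the lower-order part. -/
structure PrincipalConditions
    (u : Fin n → Fin n → Fin N → Fin N → smoothFunctions (J n N)) : Prop where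
  index_comm : ∀ μ ν A B, u μ ν A B = u ν μ A B
  field_comm : ∀ μ ν A B, u μ ν A B = u μ ν B A
  cyclic : ∀ μ ν ρ A B C, dVel C ρ (u μ ν A B) + dVel B ρ (u μ ν A C) =
    dVel A μ (u ρ ν B C) + dVel A ν (u ρ μ B C)
  symHess_comm : ∀ μ ν ρ σ A B C D,
    symHess μ ν B C (u ρ σ A D) = symHess ρ σ A D (u μ ν B C)

theorem PrincipalConditions.sub_symHess
    {u : Fin n → Fin n → Fin N → Fin N → smoothFunctions (J n N)}
    (hu : PrincipalConditions u) (L : smoothFunctions (J n N)) :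
    PrincipalConditions fun μ ν A B => u μ ν A B - symHess μ ν A B L where
  index_comm μ ν A B := by rw [hu.index_comm, symHess_index_comm]
  field_comm μ ν A B := by rw [hu.field_comm, symHess_field_comm]
  cyclic μ ν ρ A B C := by
    have h := hu.cyclic μ ν ρ A B C
    simp only [map_sub, symHess, map_add]
    rw [dirDeriv_comm _ _ (dVel B ν L), dirDeriv_comm _ _ (dVel B μ L),
      dirDeriv_comm _ _ (dVel C ν L), dirDeriv_comm _ _ (dVel C μ L),
      dirDeriv_comm (0, 0, Pi.single C (Pi.single ρ 1)) _ L,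
      dirDeriv_comm (0, 0, Pi.single C (Pi.single ρ 1)) _ L]
    linear_combination h
  symHess_comm μ ν ρ σ A B C D := by
    have h := hu.symHess_comm μ ν ρ σ A B C D
    simp only [symHess, map_sub, map_add] at h ⊢
    have e : ∀ a b c d : J n N, dirDeriv a (dirDeriv b (dirDeriv c (dirDeriv d L))) =
        dirDeriv c (dirDeriv d (dirDeriv a (dirDeriv b L))) := fun a b c d => by
      rw [dirDeriv_comm b c, dirDeriv_comm b d, dirDeriv_comm a c, dirDeriv_comm a d]
    simp only [e (0, 0, Pi.single B _)]
    linear_combination h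

section RowScaling

/-- The projection of the jet space onto the variables `ψᴬ_μ` with `μ ∈ S`. -/
noncomputable def rowProj (N : ℕ) (S : Finset (Fin n)) : J n N →L[ℝ] J n N :=
  ∑ i ∈ S ×ˢ Finset.univ, (velFunctional i.2 i.1).smulRight (0, 0, Pi.single i.2 (Pi.single i.1 1))

theorem rowProj_apply (S : Finset (Fin n)) (p : J n N) :
    rowProj N S p = ∑ i ∈ S ×ˢ Finset.univ,
      velFunctional i.2 i.1 p • ((0, 0, Pi.single i.2 (Pi.single i.1 1)) : J n N) := by
  simp [rowProj]

theorem rowProj_single (S : Finset (Fin n)) (A : Fin N) (μ : Fin n) :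
    rowProj N S (0, 0, Pi.single A (Pi.single μ 1)) =
      if μ ∈ S then (0, 0, Pi.single A (Pi.single μ 1)) else 0 := by
  have h : ∀ (ν : Fin n) (B : Fin N),
      velFunctional B ν ((0, 0, Pi.single A (Pi.single μ 1)) : J n N) =
        if ν = μ then if B = A then 1 else 0 else 0 := fun ν B => by
    rw [velFunctional_apply]
    by_cases hB : B = A
    · subst hB
      simp [Pi.single_apply]
    · simp [hB]
  rw [rowProj_apply, Finset.sum_product]
  simp only [h, ite_smul, one_smul, zero_smul]
  simp

/-- The average over rescalings of the variables `ψᴬ_μ` with `μ ∈ S`. -/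
noncomputable abbrev rowIntegral (S : Finset (Fin n)) (k : ℕ) :
    smoothFunctions (J n N) →ₗ[ℝ] smoothFunctions (J n N) :=
  scalingIntegral (rowProj N S) k

theorem dVel_rowIntegral_of_mem {S : Finset (Fin n)} {μ : Fin n} (hμ : μ ∈ S) (A : Fin N) (k : ℕ)
    (f : smoothFunctions (J n N)) :
    dVel A μ (rowIntegral S k f) = rowIntegral S (k + 1) (dVel A μ f) :=
  dirDeriv_scalingIntegral_of_fixed (by rw [rowProj_single, if_pos hμ]) k f

theorem dVel_rowIntegral_of_notMem {S : Finset (Fin n)} {μ : Fin n} (hμ : μ ∉ S) (A : Fin N)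
    (k : ℕ) (f : smoothFunctions (J n N)) :
    dVel A μ (rowIntegral S k f) = rowIntegral S k (dVel A μ f) :=
  dirDeriv_scalingIntegral_of_ker (by rw [rowProj_single, if_neg hμ]) k f

/-- Contraction of the row averages of a family of functions with the variables `ψᴬ_μ`, `μ ∈ S`. -/
noncomputable def rowContraction (S : Finset (Fin n)) (k : ℕ)
    (τ : Fin n → Fin N → smoothFunctions (J n N)) : smoothFunctions (J n N) :=
  ∑ i ∈ S, ∑ B, vel B i * rowIntegral S k (τ i B)

theorem rowContraction_add (S : Finset (Fin n)) (k : ℕ)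
    (τ σ : Fin n → Fin N → smoothFunctions (J n N)) :
    rowContraction S k (fun i B => τ i B + σ i B) =
      rowContraction S k τ + rowContraction S k σ := by
  simp only [rowContraction, map_add, mul_add, Finset.sum_add_distrib]

theorem rowContraction_congr {S : Finset (Fin n)} (k : ℕ)
    {τ σ : Fin n → Fin N → smoothFunctions (J n N)} (h : ∀ i ∈ S, ∀ B, τ i B = σ i B) :
    rowContraction S k τ = rowContraction S k σ :=
  Finset.sum_congr rfl fun i hi => Finset.sum_congr rfl fun B _ => by rw [h i hi B]

theorem rowContraction_eq_zero {S : Finset (Fin n)} (k : ℕ)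
    {τ : Fin n → Fin N → smoothFunctions (J n N)} (h : ∀ i ∈ S, ∀ B, τ i B = 0) :
    rowContraction S k τ = 0 :=
  Finset.sum_eq_zero fun i hi => Finset.sum_eq_zero fun B _ => by rw [h i hi B, map_zero, mul_zero]

theorem rowContraction_euler (S : Finset (Fin n)) (k : ℕ) (f : smoothFunctions (J n N)) :
    (k + 1 : ℝ) • rowIntegral S k f + rowContraction S (k + 1) (fun i B => dVel B i f) = f := by
  rw [rowContraction, ← Finset.sum_product']
  exact scalingIntegral_euler _ (rowProj_apply S) k f

theorem dVel_rowContraction_of_mem {S : Finset (Fin n)} {μ : Fin n} (hμ : μ ∈ S) (C : Fin N)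
    (k : ℕ) (τ : Fin n → Fin N → smoothFunctions (J n N)) :
    dVel C μ (rowContraction S k τ) =
      rowIntegral S k (τ μ C) + rowContraction S (k + 1) (fun i B => dVel C μ (τ i B)) := by
  simp only [rowContraction, map_sum, Derivation.leibniz, dVel_rowIntegral_of_mem hμ, dVel_vel,
    smul_eq_mul, Finset.sum_add_distrib]
  rw [add_comm]
  congr 1
  simp [hμ]

theorem dVel_rowContraction_of_notMem {S : Finset (Fin n)} {μ : Fin n} (hμ : μ ∉ S) (C : Fin N)
    (k : ℕ) (τ : Fin n → Fin N → smoothFunctions (J n N)) :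
    dVel C μ (rowContraction S k τ) = rowContraction S k (fun i B => dVel C μ (τ i B)) := by
  simp only [rowContraction, map_sum, Derivation.leibniz, dVel_rowIntegral_of_notMem hμ, dVel_vel,
    smul_eq_mul]
  refine Finset.sum_congr rfl fun i hi => Finset.sum_congr rfl fun B _ => ?_
  have : μ ≠ i := fun h => hμ (h ▸ hi)
  simp [this]

theorem symHess_rowContraction_of_notMem {S : Finset (Fin n)} {μ ν : Fin n} (hμ : μ ∉ S)
    (hν : ν ∉ S) (A C : Fin N) (k : ℕ) (τ : Fin n → Fin N → smoothFunctions (J n N)) :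
    symHess μ ν A C (rowContraction S k τ) =
      rowContraction S k (fun i B => symHess μ ν A C (τ i B)) := by
  simp only [symHess, dVel_rowContraction_of_notMem hμ, dVel_rowContraction_of_notMem hν,
    rowContraction_add]

/-- The Poincaré lemma in the variables of a single row. -/
theorem dVel_rowContraction_singleton (ρ : Fin n) {h : Fin N → smoothFunctions (J n N)}
    (hclosed : ∀ B C, dVel C ρ (h B) = dVel B ρ (h C)) (C : Fin N) :
    dVel C ρ (rowContraction {ρ} 0 fun _ => h) = h C := by
  rw [dVel_rowContraction_of_mem (Finset.mem_singleton_self ρ),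
    rowContraction_congr (σ := fun i B => dVel B i (h C))]
  · simpa using rowContraction_euler {ρ} 0 (h C)
  · intro i hi B
    rw [Finset.mem_singleton.1 hi, hclosed]

end RowScaling

namespace PrincipalConditions

variable {u : Fin n → Fin n → Fin N → Fin N → smoothFunctions (J n N)}

theorem exists_symHess_diagonal (hu : PrincipalConditions u) {S : Finset (Fin n)} {ρ : Fin n}
    (hρ : ρ ∉ S) (hS : ∀ μ ∈ S, ∀ ν ∈ S, ∀ A B, u μ ν A B = 0) :
    ∃ L, (∀ μ ∈ S, ∀ ν ∈ S, ∀ A B, symHess μ ν A B L = 0) ∧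
      ∀ A B, symHess ρ ρ A B L = u ρ ρ A B := by
  have hclosed : ∀ A B C, dVel C ρ (u ρ ρ B A) = dVel B ρ (u ρ ρ C A) := fun A B C => by
    have h1 := hu.cyclic ρ ρ ρ A B C
    have h2 := hu.cyclic ρ ρ ρ B A C
    rw [hu.field_comm ρ ρ B A] at h2 ⊢
    rw [hu.field_comm ρ ρ C A]
    linear_combination (norm := module) (1 / 3 : ℝ) • h1 + (2 / 3 : ℝ) • h2
  set H : Fin N → smoothFunctions (J n N) :=
    fun A => rowContraction {ρ} 0 fun _ B => u ρ ρ B A with hH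
  have hdH : ∀ A C, dVel C ρ (H A) = u ρ ρ C A := fun A C =>
    dVel_rowContraction_singleton ρ (hclosed A) C
  refine ⟨(1 / 2 : ℝ) • rowContraction {ρ} 0 fun _ => H, fun μ hμ ν hν A B => ?_, fun A B => ?_⟩
  · have hμρ : μ ∉ ({ρ} : Finset (Fin n)) := fun h => hρ (Finset.mem_singleton.1 h ▸ hμ)
    have hνρ : ν ∉ ({ρ} : Finset (Fin n)) := fun h => hρ (Finset.mem_singleton.1 h ▸ hν)
    have h0 : symHess μ ν A B (rowContraction {ρ} 0 fun _ => H) = 0 := by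
      rw [symHess_rowContraction_of_notMem hμρ hνρ]
      refine rowContraction_eq_zero _ fun i _ C => ?_
      rw [hH, symHess_rowContraction_of_notMem hμρ hνρ]
      refine rowContraction_eq_zero _ fun i _ D => ?_
      rw [hu.symHess_comm, hS μ hμ ν hν, symHess_zero]
    rw [symHess] at h0 ⊢
    simp only [Derivation.map_smul]
    rw [← smul_add, h0, smul_zero]
  · have h1 : ∀ C, dVel C ρ (rowContraction {ρ} 0 fun _ => H) = H C :=
      dVel_rowContraction_singleton ρ fun B C => by rw [hdH, hdH, hu.field_comm]
    simp only [symHess, Derivation.map_smul, h1, hdH]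
    module

theorem exists_symHess_offDiagonal (hu : PrincipalConditions u) {S : Finset (Fin n)} {ρ : Fin n}
    (hρ : ρ ∉ S) (hS : ∀ μ ∈ S, ∀ ν ∈ S, ∀ A B, u μ ν A B = 0)
    (hρρ : ∀ A B, u ρ ρ A B = 0) :
    ∃ L, (∀ μ ∈ S, ∀ ν ∈ S, ∀ A B, symHess μ ν A B L = 0) ∧
      (∀ A B, symHess ρ ρ A B L = 0) ∧ ∀ μ ∈ S, ∀ A B, symHess μ ρ A B L = u μ ρ A B := by
  have hindep : ∀ i A B C, dVel C ρ (u i ρ A B) = 0 := fun i A B C => by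
    have h1 := hu.cyclic i ρ ρ A B C
    have h2 := hu.cyclic i ρ ρ B A C
    simp only [hρρ, map_zero, hu.index_comm ρ i, zero_add] at h1 h2
    rw [hu.field_comm i ρ B A] at h2
    rw [hu.field_comm i ρ B C] at h1 h2
    linear_combination (norm := skip) (1 / 2 : ℝ) • h1 + (1 / 2 : ℝ) • h2
    rw [hu.field_comm i ρ C B]
    module
  have hanti : ∀ i ∈ S, ∀ j ∈ S, ∀ A B C,
      dVel A i (u j ρ B C) + dVel A j (u i ρ B C) = 0 := fun i hi j hj A B C => by
    have h := hu.cyclic i j ρ A B C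
    simp only [hS i hi j hj, map_zero, add_zero] at h
    rw [hu.index_comm j ρ, hu.index_comm i ρ, ← h]
  have hcyc : ∀ i ∈ S, ∀ j ∈ S, ∀ A B C,
      dVel C i (u j ρ A B) + dVel A i (u j ρ C B) = dVel B j (u i ρ A C) :=
    fun i hi j hj A B C => by
      have h := hu.cyclic j ρ i B A C
      rw [hS i hi j hj, map_zero, add_zero] at h
      rw [hu.field_comm j ρ A B, hu.field_comm j ρ C B, h]
  set Φ : Fin N → smoothFunctions (J n N) :=
    fun A => rowContraction S 1 fun i B => u i ρ A B with hΦ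
  have hΦρ : ∀ A C, dVel C ρ (Φ A) = 0 := fun A C => by
    rw [hΦ, dVel_rowContraction_of_notMem hρ]
    exact rowContraction_eq_zero _ fun i _ B => hindep i A B C
  have hΦS : ∀ i ∈ S, ∀ A C, dVel C i (Φ A) =
      rowIntegral S 1 (u i ρ A C) + rowContraction S 2 (fun j B => dVel C i (u j ρ A B)) :=
    fun i hi A C => dVel_rowContraction_of_mem hi C 1 _
  have hkilling : ∀ i ∈ S, ∀ A C, dVel C i (Φ A) + dVel A i (Φ C) = u i ρ A C :=
    fun i hi A C => by
      have h := rowContraction_euler S 1 (u i ρ A C)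
      rw [← rowContraction_congr 2 fun j hj B => hcyc i hi j hj A B C, rowContraction_add] at h
      rw [hΦS i hi, hΦS i hi, hu.field_comm i ρ C A]
      nth_rw 3 [← h]
      push_cast
      module
  have hhess : ∀ i ∈ S, ∀ j ∈ S, ∀ A B C, symHess i j B C (Φ A) = 0 :=
    fun i hi j hj A B C => by
      rw [symHess, hΦS i hi, hΦS j hj, map_add, map_add, dVel_rowIntegral_of_mem hi,
        dVel_rowIntegral_of_mem hj, dVel_rowContraction_of_mem hi, dVel_rowContraction_of_mem hj]
      have h1 := congrArg (rowIntegral S 2) (hanti i hi j hj B A C)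
      have h2 := congrArg (rowIntegral S 2) (hanti i hi j hj C A B)
      have h3 : rowContraction S 3 (fun k D => dVel B i (dVel C j (u k ρ A D))) +
          rowContraction S 3 (fun k D => dVel B j (dVel C i (u k ρ A D))) = 0 := by
        rw [← rowContraction_add]
        refine rowContraction_eq_zero _ fun k _ D => ?_
        have h := hu.symHess_comm i j k ρ A B C D
        rwa [hS i hi j hj, symHess_zero] at h
      simp only [map_add, map_zero] at h1 h2
      linear_combination h1 + h2 + h3
  have hmem : ∀ i ∈ S, i ≠ ρ := fun i hi h => hρ (h ▸ hi)
  have hL : ∀ i ∈ S, ∀ C, dVel C i (∑ A, vel A ρ * Φ A) = ∑ A, vel A ρ * dVel C i (Φ A) :=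
    fun i hi C => by simp [Derivation.leibniz, dVel_vel, hmem i hi]
  have hLρ : ∀ C, dVel C ρ (∑ A, vel A ρ * Φ A) = Φ C := fun C => by
    simp [Derivation.leibniz, dVel_vel, hΦρ]
  refine ⟨∑ A, vel A ρ * Φ A, fun i hi j hj B C => ?_, fun B C => ?_, fun i hi B C => ?_⟩
  · rw [symHess, hL i hi, hL j hj, map_sum, map_sum, ← Finset.sum_add_distrib]
    refine Finset.sum_eq_zero fun A _ => ?_
    simp only [Derivation.leibniz, dVel_vel, hmem i hi, hmem j hj, if_false, ite_self,
      smul_eq_mul]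
    have h := hhess i hi j hj A B C
    rw [symHess] at h
    linear_combination vel A ρ * h
  · rw [symHess, hLρ, hΦρ, add_zero]
  · rw [symHess, hLρ, dVel_comm B C ρ i, hLρ, add_comm, hkilling i hi]

theorem exists_symHess_eq_on (hu : PrincipalConditions u) (S : Finset (Fin n)) :
    ∃ L, ∀ μ ∈ S, ∀ ν ∈ S, ∀ A B, symHess μ ν A B L = u μ ν A B := by
  induction S using Finset.induction_on with
  | empty => exact ⟨0, by simp⟩
  | insert ρ S hρ ih =>
    obtain ⟨L, hL⟩ := ih
    obtain ⟨M, hMS, hMρ⟩ := (hu.sub_symHess L).exists_symHess_diagonal hρ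
      fun μ hμ ν hν A B => sub_eq_zero.2 (hL μ hμ ν hν A B).symm
    obtain ⟨K, hKS, hKρ, hK⟩ := ((hu.sub_symHess L).sub_symHess M).exists_symHess_offDiagonal hρ
      (fun μ hμ ν hν A B => by rw [hL μ hμ ν hν, hMS μ hμ ν hν, sub_self, sub_zero])
      fun A B => sub_eq_zero.2 (hMρ A B).symm
    refine ⟨L + M + K, fun μ hμ ν hν A B => ?_⟩
    rw [symHess_add, symHess_add]
    rcases Finset.mem_insert.1 hμ with rfl | hμ <;> rcases Finset.mem_insert.1 hν with rfl | hν
    · rw [hMρ, hKρ]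
      abel
    · have h := hK ν ‹_› A B
      rw [symHess_index_comm μ ν, symHess_index_comm μ ν, symHess_index_comm μ ν, h,
        hu.index_comm μ ν]
      abel
    · rw [hK μ ‹_›]
      abel
    · rw [hL μ hμ ν hν, hMS μ hμ ν hν, hKS μ hμ ν hν, add_zero, add_zero]

end PrincipalConditions

/-- The operator `δ/δxᵘ` as a derivation of the smooth functions. -/
noncomputable def totalDeriv (μ : Fin n) :
    Derivation ℝ (smoothFunctions (J n N)) (smoothFunctions (J n N)) :=
  dBase N μ + ∑ A, vel A μ • dField n A

theorem totalDeriv_apply (μ : Fin n) (f : smoothFunctions (J n N)) :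
    totalDeriv μ f = dBase N μ f + ∑ A, vel A μ * dField n A f := by
  rw [totalDeriv, Derivation.add_apply, ← Derivation.coeFnAddMonoidHom_apply (∑ A, _), map_sum,
    Finset.sum_apply]
  rfl

theorem totalDeriv_field (A : Fin N) (μ : Fin n) : totalDeriv μ (field n A) = vel A μ := by
  simp [totalDeriv_apply, dBase_field, dField_field]

theorem dField_totalDeriv (A : Fin N) (μ : Fin n) (f : smoothFunctions (J n N)) :
    dField n A (totalDeriv μ f) = totalDeriv μ (dField n A f) := by
  simp only [totalDeriv_apply, map_add, map_sum, Derivation.leibniz, dField_vel, smul_eq_mul,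
    mul_zero, add_zero]
  rw [dirDeriv_comm]
  refine congrArg _ (Finset.sum_congr rfl fun B _ => ?_)
  rw [dirDeriv_comm]

theorem dVel_totalDeriv (A : Fin N) (μ ν : Fin n) (f : smoothFunctions (J n N)) :
    dVel A ν (totalDeriv μ f) =
      totalDeriv μ (dVel A ν f) + if ν = μ then dField n A f else 0 := by
  simp only [totalDeriv_apply, map_add, map_sum, Derivation.leibniz, dVel_vel, smul_eq_mul,
    Finset.sum_add_distrib]
  rw [dirDeriv_comm, add_assoc]
  congr 2
  · exact Finset.sum_congr rfl fun B _ => by rw [dirDeriv_comm]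
  · simp

theorem totalDeriv_vel (A : Fin N) (μ ν : Fin n) : totalDeriv μ (vel A ν) = 0 := by
  simp [totalDeriv_apply, dBase_vel, dField_vel]

theorem totalDeriv_dBase (μ ν : Fin n) (f : smoothFunctions (J n N)) :
    totalDeriv μ (dBase N ν f) = dBase N ν (totalDeriv μ f) := by
  simp only [totalDeriv_apply, map_add, map_sum, Derivation.leibniz, dBase_vel, smul_eq_mul,
    mul_zero, add_zero]
  rw [dirDeriv_comm]
  refine congrArg _ (Finset.sum_congr rfl fun B _ => ?_)
  rw [dirDeriv_comm]

theorem totalDeriv_comm (μ ν : Fin n) (f : smoothFunctions (J n N)) :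
    totalDeriv μ (totalDeriv ν f) = totalDeriv ν (totalDeriv μ f) := by
  rw [totalDeriv_apply ν f, totalDeriv_apply ν (totalDeriv μ f)]
  simp [totalDeriv_vel, totalDeriv_dBase, dField_totalDeriv]

/-- The Euler-Lagrange expressions of a first-order Lagrangian, with only the part of `δ/δxᵘ` that
does not involve second-order variables. -/
noncomputable def eulerLagrange (A : Fin N) (L : smoothFunctions (J n N)) :
    smoothFunctions (J n N) :=
  dField n A L - ∑ μ, totalDeriv μ (dVel A μ L)

theorem eulerLagrange_add (A : Fin N) (L M : smoothFunctions (J n N)) :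
    eulerLagrange A (L + M) = eulerLagrange A L + eulerLagrange A M := by
  simp only [eulerLagrange, map_add, Finset.sum_add_distrib]
  abel

theorem dVel_eulerLagrange (A B : Fin N) (μ : Fin n) (L : smoothFunctions (J n N)) :
    dVel B μ (eulerLagrange A L) = dField n A (dVel B μ L) - dField n B (dVel A μ L) -
      ∑ ν, totalDeriv ν (dVel B μ (dVel A ν L)) := by
  simp only [eulerLagrange, map_sub, map_sum, dVel_totalDeriv, Finset.sum_add_distrib]
  rw [dirDeriv_comm]
  simp
  abel

theorem dVel_eulerLagrange_add (A B : Fin N) (μ : Fin n) (L : smoothFunctions (J n N)) :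
    dVel A μ (eulerLagrange B L) + dVel B μ (eulerLagrange A L) =
      -∑ ν, totalDeriv ν (symHess μ ν A B L) := by
  simp only [dVel_eulerLagrange, symHess, map_add, Finset.sum_add_distrib]
  rw [Finset.sum_congr rfl fun ν _ => congrArg (totalDeriv ν) (dVel_comm B A μ ν L)]
  abel

/-- The left-hand side of the zeroth-order Helmholtz condition. -/
noncomputable def helmholtz (r : Fin N → smoothFunctions (J n N)) (A B : Fin N) :
    smoothFunctions (J n N) :=
  2 * dField n B (r A) - ∑ ν, totalDeriv ν (dVel B ν (r A))

theorem helmholtz_sub (r s : Fin N → smoothFunctions (J n N)) (A B : Fin N) :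
    helmholtz (fun C => r C - s C) A B = helmholtz r A B - helmholtz s A B := by
  simp only [helmholtz, map_sub, Finset.sum_sub_distrib]
  ring

theorem helmholtz_eulerLagrange_comm (A B : Fin N) (L : smoothFunctions (J n N)) :
    helmholtz (fun C => eulerLagrange C L) A B = helmholtz (fun C => eulerLagrange C L) B A := by
  have h : ∀ A B : Fin N, helmholtz (fun C => eulerLagrange C L) A B =
      2 * dField n B (dField n A L) - ∑ ν, totalDeriv ν (dField n B (dVel A ν L)) -
        ∑ ν, totalDeriv ν (dField n A (dVel B ν L)) +
          ∑ ν, ∑ ρ, totalDeriv ν (totalDeriv ρ (dVel B ν (dVel A ρ L))) := fun A B => by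
    simp only [helmholtz, dVel_eulerLagrange]
    simp only [eulerLagrange, map_sub, map_sum, dField_totalDeriv, Finset.sum_sub_distrib]
    ring
  rw [h, h B A, dirDeriv_comm, Finset.sum_comm (γ := Fin n)]
  have h2 : ∀ ρ ν, totalDeriv ν (totalDeriv ρ (dVel B ν (dVel A ρ L))) =
      totalDeriv ρ (totalDeriv ν (dVel A ρ (dVel B ν L))) := fun ρ ν => by
    rw [totalDeriv_comm, dVel_comm]
  simp only [h2]
  ring

section FiberScaling

/-- The projection of the jet space onto the variables `ψᴬ` and `ψᴬ_μ`. -/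
noncomputable def fiberProj (n N : ℕ) : J n N →L[ℝ] J n N :=
  (ContinuousLinearMap.inr ℝ (Fin n → ℝ) _).comp (ContinuousLinearMap.snd ℝ (Fin n → ℝ) _)

theorem fiberProj_apply (p : J n N) : fiberProj n N p = (0, p.2) := rfl

/-- The average over rescalings of the variables `ψᴬ` and `ψᴬ_μ`. -/
noncomputable abbrev fiberIntegral (k : ℕ) :
    smoothFunctions (J n N) →ₗ[ℝ] smoothFunctions (J n N) :=
  scalingIntegral (fiberProj n N) k

theorem dVel_fiberIntegral (A : Fin N) (μ : Fin n) (k : ℕ) (f : smoothFunctions (J n N)) :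
    dVel A μ (fiberIntegral k f) = fiberIntegral (k + 1) (dVel A μ f) :=
  dirDeriv_scalingIntegral_of_fixed rfl k f

theorem dField_fiberIntegral (A : Fin N) (k : ℕ) (f : smoothFunctions (J n N)) :
    dField n A (fiberIntegral k f) = fiberIntegral (k + 1) (dField n A f) :=
  dirDeriv_scalingIntegral_of_fixed rfl k f

theorem totalDeriv_fiberIntegral (μ : Fin n) (k : ℕ) (f : smoothFunctions (J n N)) :
    totalDeriv μ (fiberIntegral k f) = fiberIntegral k (totalDeriv μ f) := by
  have hvel : ∀ (A : Fin N) g, fiberIntegral k (vel A μ * g) = vel A μ * fiberIntegral (k + 1) g :=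
    fun A g => scalingIntegral_linearFunction_mul_of_fixed (fun _ => rfl) k g
  have hbase : dBase N μ (fiberIntegral k f) = fiberIntegral k (dBase N μ f) :=
    dirDeriv_scalingIntegral_of_ker rfl k f
  simp only [totalDeriv_apply, map_add, map_sum, hvel, hbase, dField_fiberIntegral]

theorem fiberIntegral_euler (k : ℕ) (f : smoothFunctions (J n N)) :
    (k + 1 : ℝ) • fiberIntegral k f + (∑ A, field n A * fiberIntegral (k + 1) (dField n A f) +
      ∑ A, ∑ μ, vel A μ * fiberIntegral (k + 1) (dVel A μ f)) = f := by
  have hP : ∀ p : J n N, fiberProj n N p = ∑ i : Fin N ⊕ Fin N × Fin n,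
      Sum.elim (fieldFunctional n) (fun j => velFunctional j.1 j.2) i p •
        Sum.elim (fun A => ((0, Pi.single A 1, 0) : J n N))
          (fun j => (0, 0, Pi.single j.1 (Pi.single j.2 1))) i := fun p => by
    rw [fiberProj_apply, Fintype.sum_sum_type, Fintype.sum_prod_type]
    simp only [Sum.elim_inl, Sum.elim_inr, fieldFunctional_apply, velFunctional_apply]
    refine Prod.ext ?_ (Prod.ext ?_ ?_)
    · simp [Prod.fst_sum]
    · ext A
      simp [Prod.fst_sum, Prod.snd_sum, Finset.sum_apply, Pi.single_apply]
    · ext A μ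
      simp [Prod.snd_sum, Finset.sum_apply, Pi.single_apply]
  have h := scalingIntegral_euler Finset.univ hP k f
  rwa [Fintype.sum_sum_type, Fintype.sum_prod_type] at h

/-- Vainberg-Tonti: source forms without second-order variables that satisfy the Helmholtz
conditions come from a Lagrangian that contributes no second-order variables. -/
theorem exists_eulerLagrange_eq {r : Fin N → smoothFunctions (J n N)}
    (hvel : ∀ A B μ, dVel A μ (r B) + dVel B μ (r A) = 0)
    (hfield : ∀ A B, helmholtz r A B = helmholtz r B A) :
    ∃ L, (∀ μ ν A B, symHess μ ν A B L = 0) ∧ ∀ A, eulerLagrange A L = r A := by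
  have hskew : ∀ A B μ, dVel A μ (r B) = -dVel B μ (r A) := fun A B μ =>
    eq_neg_of_add_eq_zero_left (hvel A B μ)
  have hsym : ∀ μ ν B C A, symHess μ ν B C (r A) = 0 := fun μ ν B C A => by
    rw [symHess, hskew C A ν, map_neg, dVel_comm B A μ ν, hskew B C μ, map_neg, neg_neg,
      dVel_comm A C ν μ, hskew A B ν, map_neg, dVel_comm B C ν μ, neg_add_cancel]
  have hcross : ∀ A C, dField n C (r A) - ∑ μ, totalDeriv μ (dVel C μ (r A)) =
      dField n A (r C) := fun A C => by
    have h := hfield A C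
    simp only [helmholtz, hskew A C, map_neg, Finset.sum_neg_distrib, two_mul] at h
    linear_combination (norm := module) (1 / 2 : ℝ) • h
  have hd : ∀ C μ, dVel C μ (∑ A, field n A * fiberIntegral 0 (r A)) =
      ∑ A, field n A * fiberIntegral 1 (dVel C μ (r A)) := fun C μ => by
    simp [Derivation.leibniz, dVel_field, dVel_fiberIntegral]
  refine ⟨∑ A, field n A * fiberIntegral 0 (r A), fun μ ν B C => ?_, fun C => ?_⟩
  · simp only [symHess, hd, map_sum, Derivation.leibniz, dVel_field, dVel_fiberIntegral,
      smul_eq_mul, mul_zero, add_zero, ← Finset.sum_add_distrib, ← mul_add, ← map_add]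
    refine Finset.sum_eq_zero fun A _ => ?_
    have h := hsym μ ν B C A
    rw [symHess] at h
    rw [h, map_zero, mul_zero]
  · have h1 : dField n C (∑ A, field n A * fiberIntegral 0 (r A)) =
        fiberIntegral 0 (r C) + ∑ A, field n A * fiberIntegral 1 (dField n C (r A)) := by
      simp [Derivation.leibniz, dField_field, dField_fiberIntegral, Finset.sum_add_distrib,
        add_comm]
    have h2 : ∑ μ, totalDeriv μ (dVel C μ (∑ A, field n A * fiberIntegral 0 (r A))) =
        ∑ A, field n A * fiberIntegral 1 (∑ μ, totalDeriv μ (dVel C μ (r A))) -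
          ∑ A, ∑ μ, vel A μ * fiberIntegral 1 (dVel A μ (r C)) := by
      simp only [hd, map_sum, Derivation.leibniz, totalDeriv_field, totalDeriv_fiberIntegral,
        smul_eq_mul, Finset.mul_sum]
      rw [Finset.sum_comm, ← Finset.sum_sub_distrib]
      refine Finset.sum_congr rfl fun A _ => ?_
      rw [← Finset.sum_sub_distrib]
      refine Finset.sum_congr rfl fun μ _ => ?_
      rw [hskew A C, map_neg]
      ring
    have h3 : ∑ A, field n A * fiberIntegral 1 (dField n A (r C)) =
        ∑ A, field n A * fiberIntegral 1 (dField n C (r A)) -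
          ∑ A, field n A * fiberIntegral 1 (∑ μ, totalDeriv μ (dVel C μ (r A))) := by
      rw [← Finset.sum_sub_distrib]
      refine Finset.sum_congr rfl fun A _ => ?_
      rw [← hcross, map_sub, mul_sub]
    have h4 := fiberIntegral_euler 0 (r C)
    simp only [h3, Nat.cast_zero, zero_add, one_smul] at h4
    rw [eulerLagrange, h1, h2]
    linear_combination h4

end FiberScaling

theorem exists_symHess_eulerLagrange_eq
    {u : Fin n → Fin n → Fin N → Fin N → smoothFunctions (J n N)}
    {r : Fin N → smoothFunctions (J n N)} (hu : PrincipalConditions u)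
    (hvel : ∀ A B μ, dVel A μ (r B) + dVel B μ (r A) = -∑ ν, totalDeriv ν (u μ ν A B))
    (hfield : ∀ A B, helmholtz r A B = helmholtz r B A) :
    ∃ L, (∀ μ ν A B, symHess μ ν A B L = u μ ν A B) ∧ ∀ A, eulerLagrange A L = r A := by
  obtain ⟨L, hL⟩ := hu.exists_symHess_eq_on Finset.univ
  have hL' : ∀ μ ν A B, symHess μ ν A B L = u μ ν A B := fun μ ν A B =>
    hL μ (Finset.mem_univ _) ν (Finset.mem_univ _) A B
  obtain ⟨M, hM, hMr⟩ := exists_eulerLagrange_eq (r := fun A => r A - eulerLagrange A L)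
    (fun A B μ => by
      have h := dVel_eulerLagrange_add A B μ L
      simp only [hL'] at h
      simp only [map_sub]
      linear_combination hvel A B μ - h)
    fun A B => by rw [helmholtz_sub, helmholtz_sub, hfield, helmholtz_eulerLagrange_comm]
  exact ⟨L + M, fun μ ν A B => by rw [symHess_add, hL', hM, add_zero],
    fun A => by rw [eulerLagrange_add, hMr, add_sub_cancel]⟩

theorem totalDeriv_eq_deltaX (μ : Fin n) (f : smoothFunctions (J n N)) (p : J n N) :
    (totalDeriv μ f : J n N → ℝ) p = deltaX μ f p := by
  rw [totalDeriv_apply]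
  simp only [deltaX, Subalgebra.coe_add, Pi.add_apply, AddSubmonoidClass.coe_finsetSum,
    Finset.sum_apply]
  rfl

theorem sum_totalDeriv_eq_deltaX (f : Fin n → smoothFunctions (J n N)) (p : J n N) :
    ((∑ μ, totalDeriv μ (f μ) : smoothFunctions (J n N)) : J n N → ℝ) p =
      ∑ μ, deltaX μ (f μ) p := by
  simp only [AddSubmonoidClass.coe_finsetSum, Finset.sum_apply, totalDeriv_eq_deltaX]

theorem eulerLagrange_eq_deltaX (A : Fin N) (L : smoothFunctions (J n N)) (p : J n N) :
    (eulerLagrange A L : J n N → ℝ) p = pd0 A L p - ∑ μ, deltaX μ (pd A μ L) p :=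
  congrArg (pd0 A L p - ·) (sum_totalDeriv_eq_deltaX (fun μ => dVel A μ L) p)

theorem helmholtz_eq_deltaX (r : Fin N → smoothFunctions (J n N)) (A B : Fin N) (p : J n N) :
    (helmholtz r A B : J n N → ℝ) p =
      2 * pd0 B (r A) p - ∑ ν, deltaX ν (pd B ν (r A)) p :=
  congrArg (2 * pd0 B (r A) p - ·) (sum_totalDeriv_eq_deltaX (fun ν => dVel B ν (r A)) p)

end JetSpace

theorem order_reduction (n N : ℕ) (hn : 0 < n) (hN : 0 < N)
    (t : Fin n → Fin n → Fin N → Fin N → J n N → ℝ)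
    (t0 : Fin N → J n N → ℝ)
    (htsmooth : ∀ μ ν A B, ContDiff ℝ (⊤ : ℕ∞) (t μ ν A B))
    (ht0smooth : ∀ A, ContDiff ℝ (⊤ : ℕ∞) (t0 A))
    (heq1 : ∀ μ ν A B, t μ ν A B = t ν μ A B)
    (heq2 : ∀ μ ν A B, t μ ν A B = t μ ν B A)
    (heq3 : ∀ (μ : Fin n) (A B : Fin N) (p : J n N),
      pd A μ (t0 B) p + pd B μ (t0 A) p = 2 * ∑ ν, deltaX ν (t μ ν A B) p)
    (heq4 : ∀ (μ ν ρ : Fin n) (A B C : Fin N) (p : J n N),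
      pd C ρ (t μ ν A B) p + pd B ρ (t μ ν A C) p =
      pd A μ (t ρ ν B C) p + pd A ν (t ρ μ B C) p)
    (heq5 : ∀ (A B : Fin N) (p : J n N),
      2 * pd0 B (t0 A) p - ∑ ν, deltaX ν (pd B ν (t0 A)) p =
      2 * pd0 A (t0 B) p - ∑ ν, deltaX ν (pd A ν (t0 B)) p)
    (heq6 : ∀ (μ ν : Fin n) (A B C : Fin N) (p : J n N),
      4 * pd0 B (t μ ν A C) p - 2 * ∑ ρ, deltaX ρ (pd B ρ (t μ ν A C)) p
        - (pd B μ (pd C ν (t0 A)) p + pd B ν (pd C μ (t0 A)) p) =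
      4 * pd0 A (t μ ν B C) p - 2 * ∑ ρ, deltaX ρ (pd A ρ (t μ ν B C)) p
        - (pd A μ (pd C ν (t0 B)) p + pd A ν (pd C μ (t0 B)) p))
    (heq7 : ∀ (μ ν ρ σ : Fin n) (A B C D : Fin N) (p : J n N),
      pd B μ (pd C ν (t ρ σ A D)) p + pd B ν (pd C μ (t ρ σ A D)) p =
      pd A ρ (pd D σ (t μ ν B C)) p + pd A σ (pd D ρ (t μ ν B C)) p) :
    ∃ L : J n N → ℝ, ContDiff ℝ (⊤ : ℕ∞) L ∧
      (∀ (μ ν : Fin n) (A B : Fin N) (p : J n N),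
        t μ ν A B p = -(1/2) * (pd A μ (pd B ν L) p + pd A ν (pd B μ L) p)) ∧
      (∀ (A : Fin N) (p : J n N),
        t0 A p = pd0 A L p - ∑ μ, deltaX μ (pd A μ L) p) := by
  lift t to Fin n → Fin n → Fin N → Fin N → smoothFunctions (J n N) using htsmooth
  lift t0 to Fin N → smoothFunctions (J n N) using ht0smooth
  have hu : PrincipalConditions fun μ ν A B => (-2 : ℝ) • t μ ν A B :=
    { index_comm := fun μ ν A B => congrArg _ (Subtype.ext (heq1 μ ν A B))
      field_comm := fun μ ν A B => congrArg _ (Subtype.ext (heq2 μ ν A B))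
      cyclic := fun μ ν ρ A B C => by
        have h : dVel C ρ (t μ ν A B) + dVel B ρ (t μ ν A C) =
            dVel A μ (t ρ ν B C) + dVel A ν (t ρ μ B C) :=
          Subtype.ext (funext (heq4 μ ν ρ A B C))
        simp only [Derivation.map_smul, ← smul_add, h]
      symHess_comm := fun μ ν ρ σ A B C D => by
        have h : symHess μ ν B C (t ρ σ A D) = symHess ρ σ A D (t μ ν B C) :=
          Subtype.ext (funext (heq7 μ ν ρ σ A B C D))
        rw [symHess, symHess] at h
        simp only [symHess, Derivation.map_smul, ← smul_add, h] }
  obtain ⟨L, hL, hr⟩ := exists_symHess_eulerLagrange_eq (r := t0) hu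
    (fun A B μ => by
      have h : dVel A μ (t0 B) + dVel B μ (t0 A) = (2 : ℝ) • ∑ ν, totalDeriv ν (t μ ν A B) :=
        Subtype.ext <| funext fun p => (heq3 μ A B p).trans
          (congrArg (2 * ·) (sum_totalDeriv_eq_deltaX (t μ · A B) p).symm)
      rw [h]
      simp only [Derivation.map_smul, ← Finset.smul_sum]
      module)
    fun A B => Subtype.ext <| funext fun p => (helmholtz_eq_deltaX t0 A B p).trans
      ((heq5 A B p).trans (helmholtz_eq_deltaX t0 B A p).symm)
  refine ⟨L, contDiff_smoothFunctions L, fun μ ν A B p => ?_, fun A p => ?_⟩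
  · have h : pd A μ (pd B ν L) p + pd A ν (pd B μ L) p = -2 * (t μ ν A B : J n N → ℝ) p :=
      congrFun (congrArg Subtype.val (hL μ ν A B)) p
    rw [h]
    ring
  · rw [← eulerLagrange_eq_deltaX, hr]
end

section
/- Tonti coefficients satisfy the integrability identities: Let t^{μν}_{AB} (μ,ν = 1,…,n; A,B = 1,…,N) be first-order functions satisfying (eq1), (eq2), (eq4) and (eq7). Define L^{μν}_A(x, ψ, ψ') = ∫_0^1 λ Σ_B ψ^B t^{μν}_{AB}(x, λψ, λψ') dλ. Then the family L^{μν}_A satisfies equations (int1) and (int2). -/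
/-- The Tonti coefficient
`L^{μν}_A(x,ψ,ψ') = ∫₀¹ λ Σ_B ψᴮ t^{μν}_{AB}(x, λψ, λψ') dλ`. -/
noncomputable def tonti {n N : ℕ}
    (t : Fin n → Fin n → Fin N → Fin N → J n N → ℝ)
    (μ ν : Fin n) (A : Fin N) : J n N → ℝ :=
  fun p => ∫ l in (0:ℝ)..1, l * ∑ B, p.2.1 B * t μ ν A B (p.1, l • p.2.1, l • p.2.2)

/-- Differentiation under the integral sign for an integrand that is jointly `C^1`. -/
theorem hasFDerivAt_intervalIntegral_of_contDiff {H : Type*} [NormedAddCommGroup H]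
    [NormedSpace ℝ H] [ProperSpace H] {F : H × ℝ → ℝ} (hF : ContDiff ℝ 1 F) (a b : ℝ) (x : H) :
    HasFDerivAt (fun y => ∫ l in a..b, F (y, l))
      (∫ l in a..b, (fderiv ℝ F (x, l)).comp (ContinuousLinearMap.inl ℝ H ℝ)) x := by
  have hF' : Continuous fun q : H × ℝ =>
      (fderiv ℝ F q).comp (ContinuousLinearMap.inl ℝ H ℝ) :=
    (hF.continuous_fderiv one_ne_zero).clm_comp continuous_const
  obtain ⟨C, hC⟩ := ((isCompact_closedBall x 1).prod (isCompact_uIcc (a := a) (b := b))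
    ).exists_bound_of_continuousOn hF'.continuousOn
  refine intervalIntegral.hasFDerivAt_integral_of_dominated_of_fderiv_le
    (F := fun y l => F (y, l))
    (F' := fun y l => (fderiv ℝ F (y, l)).comp (ContinuousLinearMap.inl ℝ H ℝ))
    (bound := fun _ => C) (Metric.closedBall_mem_nhds x one_pos)
    (.of_forall fun y => (hF.continuous.comp (by fun_prop)).aestronglyMeasurable)
    ((hF.continuous.comp (by fun_prop)).intervalIntegrable _ _)
    (hF'.comp (by fun_prop : Continuous fun l : ℝ => (x, l))).aestronglyMeasurable
    (.of_forall fun l hl y hy => hC (y, l) ⟨hy, Set.uIoc_subset_uIcc hl⟩)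
    intervalIntegrable_const (.of_forall fun l _ y _ => ?_)
  exact ((hF.differentiable one_ne_zero) (y, l)).hasFDerivAt.comp y (hasFDerivAt_prodMk_left y l)

section PartialDerivatives

variable {n N : ℕ}

theorem ContDiff.pd {f : J n N → ℝ} (hf : ContDiff ℝ (⊤ : ℕ∞) f) (A : Fin N) (μ : Fin n) :
    ContDiff ℝ (⊤ : ℕ∞) (pd A μ f) :=
  (hf.fderiv_right (m := (⊤ : ℕ∞)) (by simp)).clm_apply contDiff_const

theorem pd_add {f g : J n N → ℝ} (hf : ContDiff ℝ (⊤ : ℕ∞) f) (hg : ContDiff ℝ (⊤ : ℕ∞) g)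
    (A : Fin N) (μ : Fin n) (p : J n N) :
    pd A μ (fun q => f q + g q) p = pd A μ f p + pd A μ g p := by
  simp only [pd]
  rw [fderiv_fun_add (hf.differentiable (by simp) p) (hg.differentiable (by simp) p)]
  rfl

theorem pd_comm {f : J n N → ℝ} (hf : ContDiff ℝ (⊤ : ℕ∞) f) (A B : Fin N) (μ ν : Fin n)
    (p : J n N) : pd A μ (pd B ν f) p = pd B ν (pd A μ f) p := by
  have hd : DifferentiableAt ℝ (fderiv ℝ f) p :=
    (hf.fderiv_right (m := (⊤ : ℕ∞)) (by simp)).differentiable (by simp) p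
  have key (u v : J n N) :
      fderiv ℝ (fun q => fderiv ℝ f q v) p u = fderiv ℝ (fderiv ℝ f) p u v := by
    rw [fderiv_clm_apply hd (differentiableAt_const v)]
    simp
  change fderiv ℝ (fun q => fderiv ℝ f q _) p _ = fderiv ℝ (fun q => fderiv ℝ f q _) p _
  rw [key, key]
  exact hf.contDiffAt.isSymmSndFDerivAt
    (by simpa using WithTop.coe_le_coe.2 (le_top : (2 : ℕ∞) ≤ ⊤)) _ _

/-- The weighted radial average `∫₀¹ λᵏ Σ_B ψᴮ g_B(x, λψ, λψ') dλ`. -/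
noncomputable def radialMoment (k : ℕ) (g : Fin N → J n N → ℝ) : J n N → ℝ :=
  fun p => ∫ l in (0:ℝ)..1, l ^ k * ∑ B, p.2.1 B * g B (p.1, l • p.2.1, l • p.2.2)

theorem tonti_eq_radialMoment (t : Fin n → Fin n → Fin N → Fin N → J n N → ℝ) (μ ν : Fin n)
    (A : Fin N) : tonti t μ ν A = radialMoment 1 (t μ ν A) := by
  funext p
  simp only [radialMoment, tonti, pow_one]

theorem contDiff_radialMoment_integrand {g : Fin N → J n N → ℝ}
    (hg : ∀ B, ContDiff ℝ (⊤ : ℕ∞) (g B)) (k : ℕ) :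
    ContDiff ℝ (⊤ : ℕ∞) fun q : J n N × ℝ =>
      q.2 ^ k * ∑ B, q.1.2.1 B * g B (q.1.1, q.2 • q.1.2.1, q.2 • q.1.2.2) := by
  refine (contDiff_snd.pow k).mul (ContDiff.sum fun B _ => ?_)
  refine ContDiff.mul (by fun_prop) ((hg B).comp ?_)
  fun_prop

theorem radialMoment_add {g h : Fin N → J n N → ℝ} (hg : ∀ B, ContDiff ℝ (⊤ : ℕ∞) (g B))
    (hh : ∀ B, ContDiff ℝ (⊤ : ℕ∞) (h B)) (k : ℕ) (p : J n N) :
    radialMoment k g p + radialMoment k h p =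
      radialMoment k (fun B q => g B q + h B q) p := by
  have hint {f : Fin N → J n N → ℝ} (hf : ∀ B, ContDiff ℝ (⊤ : ℕ∞) (f B)) :=
    ((contDiff_radialMoment_integrand hf k).continuous.comp
      (by fun_prop : Continuous fun l : ℝ => (p, l))).intervalIntegrable
        (μ := MeasureTheory.volume) 0 1
  refine (intervalIntegral.integral_add (hint hg) (hint hh)).symm.trans ?_
  simp [radialMoment, mul_add, Finset.sum_add_distrib]

theorem pd_radialMoment {g : Fin N → J n N → ℝ} (hg : ∀ B, ContDiff ℝ (⊤ : ℕ∞) (g B)) (k : ℕ)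
    (A : Fin N) (μ : Fin n) :
    pd A μ (radialMoment k g) = radialMoment (k + 1) fun B => pd A μ (g B) := by
  funext p
  have hF := (contDiff_radialMoment_integrand hg k).of_le (m := 1) (by simp)
  set F := fun q : J n N × ℝ =>
    q.2 ^ k * ∑ B, q.1.2.1 B * g B (q.1.1, q.2 • q.1.2.1, q.2 • q.1.2.2) with hFdef
  have hF' : Continuous fun l : ℝ =>
      (fderiv ℝ F (p, l)).comp (ContinuousLinearMap.inl ℝ (J n N) ℝ) :=
    ((hF.continuous_fderiv one_ne_zero).comp (by fun_prop)).clm_comp continuous_const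
  set v : J n N := (0, 0, Pi.single A (Pi.single μ (1 : ℝ))) with hv
  have hd := (hasFDerivAt_intervalIntegral_of_contDiff hF 0 1 p).fderiv
  change fderiv ℝ (fun y => ∫ l in (0:ℝ)..1, F (y, l)) p v = _
  rw [hd, ContinuousLinearMap.intervalIntegral_apply (hF'.intervalIntegrable _ _)]
  refine intervalIntegral.integral_congr fun l _ => ?_
  have h₁ : HasLineDerivAt ℝ (fun y => F (y, l))
      ((fderiv ℝ F (p, l)).comp (ContinuousLinearMap.inl ℝ (J n N) ℝ) v) p v :=
    HasFDerivAt.hasLineDerivAt (f := fun y => F (y, l))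
      (HasFDerivAt.comp (g := F) (f := fun y : J n N => (y, l)) p
        ((hF.differentiable one_ne_zero) (p, l)).hasFDerivAt
        (hasFDerivAt_prodMk_left p l)) v
  refine h₁.unique ?_
  have h₂ (B : Fin N) : HasDerivAt
      (fun s : ℝ => g B (p.1, l • p.2.1, l • (p.2.2 + s • v.2.2)))
      (l * pd A μ (g B) (p.1, l • p.2.1, l • p.2.2)) 0 := by
    have hline : HasDerivAt
        (fun s : ℝ => ((p.1, l • p.2.1, l • p.2.2) : J n N) + s • l • v) (l • v) 0 := by
      simpa using ((hasDerivAt_id (0 : ℝ)).smul_const (l • v)).const_add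
        ((p.1, l • p.2.1, l • p.2.2) : J n N)
    have hgd := ((hg B).differentiable (by simp)
      ((p.1, l • p.2.1, l • p.2.2) + (0 : ℝ) • l • v)).hasFDerivAt.comp_hasDerivAt 0 hline
    have hfun : (fun s : ℝ => g B (p.1, l • p.2.1, l • (p.2.2 + s • v.2.2))) =
        g B ∘ fun s : ℝ => ((p.1, l • p.2.1, l • p.2.2) : J n N) + s • l • v := by
      funext s
      simp [hv, smul_add, smul_comm s l]
    rw [hfun]
    refine hgd.congr_deriv ?_
    rw [zero_smul, add_zero, map_smul, smul_eq_mul]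
    rfl
  have h₃ := (HasDerivAt.fun_sum (u := Finset.univ)
    fun B _ => (h₂ B).const_mul (p.2.1 B)).const_mul (l ^ k)
  have hfun : (fun s : ℝ => F (p + s • v, l)) = fun s =>
      l ^ k * ∑ B, p.2.1 B * g B (p.1, l • p.2.1, l • (p.2.2 + s • v.2.2)) := by
    funext s
    simp [hFdef, hv]
  change HasDerivAt (fun s : ℝ => F (p + s • v, l)) _ 0
  rw [hfun]
  refine h₃.congr_deriv ?_
  rw [pow_succ, mul_assoc, Finset.mul_sum (a := l)]
  congr 1
  exact Finset.sum_congr rfl fun B _ => by ring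

end PartialDerivatives

theorem tonti_coefficients_integrability (n N : ℕ) (hn : 0 < n) (hN : 0 < N)
    (t : Fin n → Fin n → Fin N → Fin N → J n N → ℝ)
    (htsmooth : ∀ μ ν A B, ContDiff ℝ (⊤ : ℕ∞) (t μ ν A B))
    (heq1 : ∀ μ ν A B, t μ ν A B = t ν μ A B)
    (heq2 : ∀ μ ν A B, t μ ν A B = t μ ν B A)
    (heq4 : ∀ (μ ν ρ : Fin n) (A B C : Fin N) (p : J n N),
      pd C ρ (t μ ν A B) p + pd B ρ (t μ ν A C) p =
      pd A μ (t ρ ν B C) p + pd A ν (t ρ μ B C) p)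
    (heq7 : ∀ (μ ν ρ σ : Fin n) (A B C D : Fin N) (p : J n N),
      pd B μ (pd C ν (t ρ σ A D)) p + pd B ν (pd C μ (t ρ σ A D)) p =
      pd A ρ (pd D σ (t μ ν B C)) p + pd A σ (pd D ρ (t μ ν B C)) p) :
    (∀ (μ ν ρ : Fin n) (A B : Fin N) (p : J n N),
      pd B ρ (tonti t μ ν A) p + pd B μ (tonti t ρ ν A) p
        + pd B ν (tonti t μ ρ A) p =
      pd A ρ (tonti t μ ν B) p + pd A μ (tonti t ρ ν B) p
        + pd A ν (tonti t μ ρ B) p) ∧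
    (∀ (μ ν ρ σ : Fin n) (A B C : Fin N) (p : J n N),
      pd B μ (fun q => pd C ρ (tonti t σ ν A) q + pd C σ (tonti t ρ ν A) q) p
      + pd B ν (fun q => pd C ρ (tonti t σ μ A) q + pd C σ (tonti t ρ μ A) q) p
      - (pd A μ (pd B ν (tonti t σ ρ C)) p + pd A ν (pd B μ (tonti t σ ρ C)) p)
      - (pd A ρ (pd C σ (tonti t μ ν B)) p
          + pd A σ (pd C ρ (tonti t μ ν B)) p) = 0) := by
  have hpd (μ ν A B C ρ) : ContDiff ℝ (⊤ : ℕ∞) (pd C ρ (t μ ν A B)) := (htsmooth μ ν A B).pd C ρ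
  have hpd2 (μ ν A B C ρ D σ) : ContDiff ℝ (⊤ : ℕ∞) (pd D σ (pd C ρ (t μ ν A B))) :=
    (hpd μ ν A B C ρ).pd D σ
  have hone (μ ν A C ρ) :
      pd C ρ (tonti t μ ν A) = radialMoment 2 fun B => pd C ρ (t μ ν A B) := by
    rw [tonti_eq_radialMoment, pd_radialMoment (htsmooth μ ν A)]
  have htwo (μ ν A C ρ D σ) : pd D σ (pd C ρ (tonti t μ ν A)) =
      radialMoment 3 fun B => pd D σ (pd C ρ (t μ ν A B)) := by
    rw [hone, pd_radialMoment fun B => hpd μ ν A B C ρ]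
  constructor
  · intro μ ν ρ A B p
    simp only [hone]
    rw [radialMoment_add (fun _ => hpd ..) (fun _ => hpd ..),
      radialMoment_add (fun _ => (hpd ..).add (hpd ..)) (fun _ => hpd ..),
      radialMoment_add (fun _ => hpd ..) (fun _ => hpd ..),
      radialMoment_add (fun _ => (hpd ..).add (hpd ..)) (fun _ => hpd ..)]
    congr 1
    funext D q
    have key (A B C : Fin N) :
        (pd C ρ (t μ ν A B) q + pd C μ (t ρ ν A B) q + pd C ν (t μ ρ A B) q) +
        (pd B ρ (t μ ν A C) q + pd B μ (t ρ ν A C) q + pd B ν (t μ ρ A C) q) =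
        2 * (pd A ρ (t μ ν B C) q + pd A μ (t ρ ν B C) q + pd A ν (t μ ρ B C) q) := by
      have h₁ := heq4 μ ν ρ A B C q
      have h₂ := heq4 ρ ν μ A B C q
      have h₃ := heq4 μ ρ ν A B C q
      simp only [heq1 ρ μ, heq1 ν μ, heq1 ν ρ] at h₁ h₂ h₃ ⊢
      linarith
    have h₁ := key A D B
    have h₂ := key B D A
    simp only [heq2 _ _ D A, heq2 _ _ D B, heq2 _ _ B A] at h₁ h₂
    linarith
  · intro μ ν ρ σ A B C p
    have hsum (κ : Fin n) : (fun q => pd C ρ (tonti t σ κ A) q + pd C σ (tonti t ρ κ A) q) =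
        radialMoment 2 fun D q => pd D κ (t ρ σ C A) q + pd A κ (t ρ σ C D) q := by
      funext q
      rw [hone, hone, radialMoment_add (fun _ => hpd ..) (fun _ => hpd ..)]
      congr 1
      funext D q
      have h := heq4 ρ σ κ C A D q
      rw [h, heq1 κ σ, heq1 κ ρ]
    rw [hsum μ, hsum ν, pd_radialMoment fun _ => (hpd ..).add (hpd ..),
      pd_radialMoment fun _ => (hpd ..).add (hpd ..)]
    simp only [htwo]
    rw [sub_sub, sub_eq_zero]
    have hadd (κ τ D q) : pd B κ (fun q => pd D τ (t ρ σ C A) q + pd A τ (t ρ σ C D) q) q =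
        pd B κ (pd D τ (t ρ σ C A)) q + pd B κ (pd A τ (t ρ σ C D)) q :=
      pd_add (hpd ..) (hpd ..) ..
    rw [radialMoment_add (fun _ => ((hpd ..).add (hpd ..)).pd ..)
        (fun _ => ((hpd ..).add (hpd ..)).pd ..),
      radialMoment_add (fun _ => hpd2 ..) (fun _ => hpd2 ..),
      radialMoment_add (fun _ => hpd2 ..) (fun _ => hpd2 ..),
      radialMoment_add (fun _ => (hpd2 ..).add (hpd2 ..)) (fun _ => (hpd2 ..).add (hpd2 ..))]
    congr 1
    funext D q
    rw [hadd, hadd, heq1 σ ρ, pd_comm (htsmooth ρ σ C D) B A μ ν,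
      pd_comm (htsmooth ρ σ C D) B A ν μ]
    have h := heq7 μ ν ρ σ A B D C q
    rw [heq2 _ _ A C] at h
    linarith
end
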